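/- arXiv:1506.01240 — 11 statements merged into one kernel-verified Lean document; each statement's English description precedes it below -/
import Mathlib

section
/- If a graph G admits an integer additive set-graceful labeling f with respect to a ground set X with |X| ≥ 2, then 0 ∈ X and there exists a vertex v of G with f(v) = {0}. -/
open Finset Pointwise

/-- `f` is an integer additive set-graceful labeling (IASGL) of `G` with respect to the
ground set `X`: `f` is injective, assigns nonempty subsets of `X` to vertices, the induced
edge function `f⁺(uv) = f u + f v` (sumset) is injective on edges, and its image is exactly
the collection of subsets of `X` other than `∅` and `{0}`. -/
def IsIASGL {V : Type*} (G : SimpleGraph V) (X : Finset ℕ) (f : V → Finset ℕ) : Prop :=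
  Function.Injective f ∧
  (∀ v, (f v).Nonempty ∧ f v ⊆ X) ∧
  (∀ u v u' v', G.Adj u v → G.Adj u' v' → f u + f v = f u' + f v' → s(u, v) = s(u', v')) ∧
  (∀ A : Finset ℕ, (∃ u v, G.Adj u v ∧ f u + f v = A) ↔ A ⊆ X ∧ A.Nonempty ∧ A ≠ {0})

/-- `T` is a topology on the finite ground set `X`: a family of subsets of `X`
containing `∅` and `X` and closed under pairwise unions and intersections. -/
def IsTopologyFamily (X : Finset ℕ) (T : Set (Finset ℕ)) : Prop :=
  (∀ A ∈ T, A ⊆ X) ∧ (∅ : Finset ℕ) ∈ T ∧ X ∈ T ∧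
  (∀ A ∈ T, ∀ B ∈ T, A ∪ B ∈ T) ∧ (∀ A ∈ T, ∀ B ∈ T, A ∩ B ∈ T)

/-- `f` is a topological integer additive set-labeling (Top-IASL) of `G` w.r.t. `X`. -/
def IsTopIASL {V : Type*} (G : SimpleGraph V) (X : Finset ℕ) (f : V → Finset ℕ) : Prop :=
  Function.Injective f ∧
  (∀ v, (f v).Nonempty ∧ f v ⊆ X) ∧
  (∀ u v, G.Adj u v → f u + f v ⊆ X) ∧
  IsTopologyFamily X (insert ∅ (Set.range f))

/-- `f` is a topological integer additive set-graceful labeling (Top-IASGL) of `G`. -/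
def IsTopIASGL {V : Type*} (G : SimpleGraph V) (X : Finset ℕ) (f : V → Finset ℕ) : Prop :=
  IsIASGL G X f ∧ IsTopologyFamily X (insert ∅ (Set.range f))

theorem stmt_0 {V : Type*} (G : SimpleGraph V) (X : Finset ℕ) (hX : 2 ≤ X.card)
    (f : V → Finset ℕ) (hf : IsIASGL G X f) :
    0 ∈ X ∧ ∃ v : V, f v = ({0} : Finset ℕ) := by
  obtain ⟨-, hsub, -, himg⟩ := hf
  suffices h : ∃ v : V, f v = ({0} : Finset ℕ) by
    obtain ⟨v, hv⟩ := h
    exact ⟨(hsub v).2 (by simp [hv]), v, hv⟩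
  have hne : (X.erase 0).Nonempty := by
    have := Finset.pred_card_le_card_erase (s := X) (a := 0)
    exact Finset.card_pos.mp (by omega)
  obtain ⟨x, hx, hmin⟩ := (X.erase 0).exists_min_image id hne
  obtain ⟨hx0, hxX⟩ := Finset.mem_erase.mp hx
  obtain ⟨u, v, -, huv⟩ := (himg {x}).mpr ⟨by simpa using hxX, by simp, by simpa using hx0⟩
  have hsum : ∀ a ∈ f u, ∀ b ∈ f v, a + b = x := fun a ha b hb =>
    Finset.mem_singleton.mp (huv ▸ Finset.add_mem_add ha hb)
  have hle : ∀ w, ∀ a ∈ f w, a ≠ 0 → x ≤ a := fun w a ha h0 =>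
    hmin a (Finset.mem_erase.mpr ⟨h0, (hsub w).2 ha⟩)
  obtain ⟨a, ha⟩ := (hsub u).1
  obtain ⟨b, hb⟩ := (hsub v).1
  have hab := hsum a ha b hb
  by_cases h0 : a = 0
  · subst h0
    refine ⟨u, Finset.eq_singleton_iff_unique_mem.mpr ⟨ha, fun c hc => ?_⟩⟩
    have := hsum c hc b hb
    omega
  · have hxa := hle u a ha h0
    obtain rfl : b = 0 := by omega
    refine ⟨v, Finset.eq_singleton_iff_unique_mem.mpr ⟨hb, fun c hc => ?_⟩⟩
    have := hsum a ha c hc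
    omega
end

section
/- If a graph G admits an integer additive set-graceful labeling with respect to a ground set X with |X| ≥ 2, then G has at least |X| − 1 pendant vertices. -/
open Finset Pointwise

/-- A set `{0, x, y}` is a sum of two distinct finite sets of naturals only if one of them
is `{0}`. -/
theorem eq_zero_or_eq_zero_of_add_eq_triple {A B : Finset ℕ} {x y : ℕ} (hne : A ≠ B)
    (h : A + B = {0, x, y}) : A = {0} ∨ B = {0} := by
  obtain ⟨a₀, ha₀, b₀, hb₀, hab⟩ : ∃ a ∈ A, ∃ b ∈ B, a + b = 0 := by
    rw [← Finset.mem_add, h]; simp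
  obtain ⟨rfl, rfl⟩ : a₀ = 0 ∧ b₀ = 0 := by omega
  by_contra! hcon
  have exists_ne_zero : ∀ C : Finset ℕ, 0 ∈ C → C ≠ {0} → ∃ c ∈ C, c ≠ 0 := by
    intro C hC hC'
    by_contra! hall
    exact hC' (Finset.eq_singleton_iff_unique_mem.2 ⟨hC, hall⟩)
  obtain ⟨a, ha, b, hb, ha0, hb0, hab'⟩ : ∃ a ∈ A, ∃ b ∈ B, a ≠ 0 ∧ b ≠ 0 ∧ a ≠ b := by
    obtain ⟨a, ha, ha0⟩ := exists_ne_zero A ha₀ hcon.1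
    obtain ⟨b, hb, hb0⟩ := exists_ne_zero B hb₀ hcon.2
    by_contra! hall
    refine hne (Finset.ext fun c => ?_)
    grind
  have mem_triple : ∀ c ∈ A, ∀ d ∈ B, c + d = 0 ∨ c + d = x ∨ c + d = y := by
    intro c hc d hd
    simpa [h] using Finset.add_mem_add hc hd
  have h₁ := mem_triple a ha 0 hb₀
  have h₂ := mem_triple 0 ha₀ b hb
  have h₃ := mem_triple a ha b hb
  omega

/-- The ground set of an IASGL contains `0`. -/
theorem IsIASGL.zero_mem {V : Type*} {G : SimpleGraph V} {X : Finset ℕ} {f : V → Finset ℕ}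
    (hf : IsIASGL G X f) (hX : X.Nonempty) : 0 ∈ X := by
  by_contra h0
  have hmin := X.min'_mem hX
  have hmin0 : X.min' hX ≠ 0 := fun h => h0 (h ▸ hmin)
  obtain ⟨u, v, -, huv⟩ := (hf.2.2.2 {X.min' hX}).2 ⟨by simpa using hmin, by simp, by simpa⟩
  obtain ⟨⟨a, ha⟩, hu⟩ := hf.2.1 u
  obtain ⟨⟨b, hb⟩, hv⟩ := hf.2.1 v
  have hab : a + b = X.min' hX := by simpa [huv] using Finset.add_mem_add ha hb
  have := X.min'_le a (hu ha)
  have := X.min'_le b (hv hb)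
  omega

/-- A vertex whose label contains the maximum of the ground set can only be adjacent to the
vertex labeled `{0}`. -/
theorem IsIASGL.eq_zero_of_adj {V : Type*} {G : SimpleGraph V} {X : Finset ℕ}
    {f : V → Finset ℕ} (hf : IsIASGL G X f) {M : ℕ} (hM : ∀ x ∈ X, x ≤ M) {v w : V}
    (hv : M ∈ f v) (hvw : G.Adj v w) : f w = {0} := by
  refine Finset.eq_singleton_iff_nonempty_unique_mem.2 ⟨(hf.2.1 w).1, fun b hb => ?_⟩
  have := hM _ (((hf.2.2.2 _).1 ⟨v, w, hvw, rfl⟩).1 (Finset.add_mem_add hv hb))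
  omega

/-- In an IASGL, each subset `{0, x, y} ≠ {0}` of the ground set labels a vertex adjacent to the
vertex labeled `{0}`. -/
theorem IsIASGL.exists_adj_of_triple {V : Type*} {G : SimpleGraph V} {X : Finset ℕ}
    {f : V → Finset ℕ} (hf : IsIASGL G X f) {x y : ℕ} (h0 : 0 ∈ X) (hx : x ∈ X) (hy : y ∈ X)
    (hx0 : x ≠ 0) : ∃ v w, G.Adj v w ∧ f v = {0, x, y} ∧ f w = {0} := by
  obtain ⟨u, v, huv, h⟩ := (hf.2.2.2 {0, x, y}).2
    ⟨by grind, by simp, fun h => hx0 (by simpa [h] using (by simp : x ∈ ({0, x, y} : Finset ℕ)))⟩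
  rcases eq_zero_or_eq_zero_of_add_eq_triple (hf.1.ne huv.ne) h with hu | hv
  · exact ⟨v, u, huv.symm, by rw [← h, hu]; exact (zero_add (f v)).symm, hu⟩
  · exact ⟨u, v, huv, by rw [← h, hv]; exact (add_zero (f u)).symm, hv⟩

theorem stmt_1 {V : Type*} [Fintype V] [DecidableEq V] (G : SimpleGraph V)
    [DecidableRel G.Adj] (X : Finset ℕ) (hX : 2 ≤ X.card)
    (f : V → Finset ℕ) (hf : IsIASGL G X f) :
    X.card - 1 ≤ (Finset.univ.filter fun v => G.degree v = 1).card := by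
  have hne : X.Nonempty := Finset.card_pos.1 (by omega)
  have h0 := hf.zero_mem hne
  set M := X.max' hne
  have hM : ∀ x ∈ X, x ≤ M := X.le_max'
  have exists_pendant : ∀ x ∈ X.erase 0, ∃ v, f v = {0, x, M} ∧ G.degree v = 1 := by
    intro x hx
    obtain ⟨hx0, hx⟩ := Finset.mem_erase.1 hx
    obtain ⟨v, w, hvw, hv, hw⟩ := hf.exists_adj_of_triple h0 hx (X.max'_mem hne) hx0
    refine ⟨v, hv, SimpleGraph.degree_eq_one_iff_existsUnique_adj.2 ⟨w, hvw, fun w' hvw' => ?_⟩⟩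
    exact hf.1 ((hf.eq_zero_of_adj hM (by simp [hv, M]) hvw').trans hw.symm)
  have : Nonempty V := by
    obtain ⟨v, -⟩ := (hf.2.2.2 X).2 ⟨subset_rfl, hne, fun h => by simp [h] at hX⟩
    exact ⟨v⟩
  choose! g hg using exists_pendant
  rw [← Finset.card_erase_of_mem h0]
  refine Finset.card_le_card_of_injOn g (fun x hx => by simpa using (hg x hx).2) ?_
  intro x hx y hy hxy
  have h : ({0, x, M} : Finset ℕ) = {0, y, M} := by rw [← (hg x hx).1, ← (hg y hy).1, hxy]
  have hx' : x ∈ ({0, y, M} : Finset ℕ) := by simp [← h]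
  have hy' : y ∈ ({0, x, M} : Finset ℕ) := by simp [h]
  simp only [Finset.coe_erase, Set.mem_sdiff, Set.mem_singleton_iff] at hx hy
  simp only [Finset.mem_insert, Finset.mem_singleton] at hx' hy'
  omega
end

section
/- Let f be an integer additive set-graceful labeling of a graph G with respect to a ground set X with |X| ≥ 2, and let A be a nonempty subset of X with A ≠ {0} such that A cannot be written as A = B + C for any nonempty subsets B, C of X with B ≠ {0} and C ≠ {0}. Then there exist adjacent vertices u and v of G with f(v) = {0} and f(u) = A. -/
open Finset Pointwise

theorem stmt_2 {V : Type*} (G : SimpleGraph V) (X : Finset ℕ) (hX : 2 ≤ X.card)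
    (f : V → Finset ℕ) (hf : IsIASGL G X f)
    (A : Finset ℕ) (hA : A ⊆ X) (hAne : A.Nonempty) (hA0 : A ≠ ({0} : Finset ℕ))
    (hsum : ¬ ∃ B C : Finset ℕ, B ⊆ X ∧ C ⊆ X ∧ B.Nonempty ∧ C.Nonempty ∧
      B ≠ ({0} : Finset ℕ) ∧ C ≠ ({0} : Finset ℕ) ∧ A = B + C) :
    ∃ u v : V, G.Adj u v ∧ f v = ({0} : Finset ℕ) ∧ f u = A := by
  obtain ⟨-, hsub, -, himg⟩ := hf
  obtain ⟨u, v, huv, huvA⟩ := (himg A).2 ⟨hA, hAne, hA0⟩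
  by_cases hv : f v = {0}
  · exact ⟨u, v, huv, hv, by simpa [hv, Finset.singleton_zero] using huvA⟩
  by_cases hu : f u = {0}
  · exact ⟨v, u, huv.symm, hu, by simpa [hu, Finset.singleton_zero] using huvA⟩
  exact absurd ⟨f u, f v, (hsub u).2, (hsub v).2, (hsub u).1, (hsub v).1, hu, hv, huvA.symm⟩ hsum
end

section
/- Let f be an integer additive set-graceful labeling of a connected graph G (with at least two vertices) with respect to a ground set X with |X| ≥ 2, and let x_n be the maximal element of X. If x_n ∈ f(v) for a vertex v of G, then v is a pendant vertex (it has degree 1) and its unique neighbour u satisfies f(u) = {0}. -/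
open Finset Pointwise

theorem stmt_3 {V : Type*} [Fintype V] [DecidableEq V] (G : SimpleGraph V)
    [DecidableRel G.Adj] (hconn : G.Connected) (hV : 2 ≤ Fintype.card V)
    (X : Finset ℕ) (hX : 2 ≤ X.card) (f : V → Finset ℕ) (hf : IsIASGL G X f)
    (v : V) (hv : X.max' (Finset.card_pos.mp (by omega)) ∈ f v) :
    G.degree v = 1 ∧ ∀ u : V, G.Adj v u → f u = ({0} : Finset ℕ) := by
  have : Nontrivial V := Fintype.one_lt_card_iff_nontrivial.mp hV
  obtain ⟨hinj, hsub, -, himg⟩ := hf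
  have hzero : ∀ u, G.Adj v u → f u = ({0} : Finset ℕ) := fun u huv =>
    Finset.eq_singleton_iff_nonempty_unique_mem.mpr ⟨(hsub u).1, fun b hb => by
      have hmem := ((himg (f v + f u)).mp ⟨v, u, huv, rfl⟩).1 (Finset.add_mem_add hv hb)
      have hle := X.le_max' _ hmem
      omega⟩
  refine ⟨le_antisymm ?_ (hconn.preconnected.degree_pos_of_nontrivial v), hzero⟩
  rw [← G.card_neighborFinset_eq_degree, Finset.card_le_one]
  intro a ha b hb
  rw [SimpleGraph.mem_neighborFinset] at ha hb
  exact hinj ((hzero a ha).trans (hzero b hb).symm)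
end

section
/- Let X be a finite set of non-negative integers with 0 ∈ X and |X| ≥ 2. A tree G (a connected acyclic graph) admits an integer additive set-graceful labeling with respect to X if and only if G is isomorphic to the star K_{1, 2^{|X|} − 2}. -/
open Finset Pointwise

theorem Finset.sup_id_add_of_nonempty {A B : Finset ℕ} (hA : A.Nonempty) (hB : B.Nonempty) :
    (A + B).sup id = A.sup id + B.sup id := by
  apply le_antisymm
  · refine Finset.sup_le fun x hx => ?_
    obtain ⟨a, ha, b, hb, rfl⟩ := Finset.mem_add.1 hx
    exact add_le_add (Finset.le_sup (f := id) ha) (Finset.le_sup (f := id) hb)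
  · obtain ⟨a, ha, ha'⟩ := Finset.exists_mem_eq_sup A hA id
    obtain ⟨b, hb, hb'⟩ := Finset.exists_mem_eq_sup B hB id
    rw [ha', hb']
    exact Finset.le_sup (f := id) (Finset.add_mem_add ha hb)

theorem Finset.sup_id_pos_of_ne_singleton_zero {A : Finset ℕ} (hA : A.Nonempty) (h : A ≠ {0}) :
    0 < A.sup id := by
  by_contra h0
  refine h (Finset.eq_singleton_iff_nonempty_unique_mem.2 ⟨hA, fun x hx => ?_⟩)
  have : x ≤ A.sup id := Finset.le_sup (f := id) hx
  omega

/-- The subsets of `X` other than `∅` and `{0}`. -/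
def gracefulLabels (X : Finset ℕ) : Finset (Finset ℕ) :=
  (X.powerset.erase ∅).erase {0}

theorem mem_gracefulLabels {X A : Finset ℕ} :
    A ∈ gracefulLabels X ↔ A ⊆ X ∧ A.Nonempty ∧ A ≠ {0} := by
  simp only [gracefulLabels, Finset.mem_erase, Finset.mem_powerset, Finset.nonempty_iff_ne_empty]
  tauto

theorem card_gracefulLabels {X : Finset ℕ} (h0 : 0 ∈ X) :
    (gracefulLabels X).card = 2 ^ X.card - 2 := by
  rw [gracefulLabels, Finset.card_erase_of_mem, Finset.card_erase_of_mem, Finset.card_powerset]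
  · omega
  · simp
  · simp [h0]

namespace SimpleGraph

variable {V : Type*} {G : SimpleGraph V}

theorem sum_degree_mul [Fintype V] [DecidableEq V] [DecidableRel G.Adj] (w : V → ℕ) :
    ∑ v, G.degree v * w v = ∑ e ∈ G.edgeFinset, ∑ v ∈ e.toFinset, w v := by
  have : ∀ v, G.degree v * w v = ∑ e ∈ G.incidenceFinset v, w v := fun v => by simp
  simp_rw [this]
  refine Finset.sum_comm' fun v e => ?_
  simp [incidenceSet, and_comm]

theorem Connected.adj_iff_of_degree_eq_one [Fintype V] [DecidableRel G.Adj] (hG : G.Connected)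
    {c : V} (h : ∀ v, v ≠ c → G.degree v = 1) (u v : V) :
    G.Adj u v ↔ (u = c ∧ v ≠ c) ∨ (u ≠ c ∧ v = c) := by
  have center : ∀ v, v ≠ c → ∀ w, G.Adj v w → w = c := by
    intro v hv w hvw
    by_contra hw
    obtain ⟨a, -, ha⟩ := degree_eq_one_iff_existsUnique_adj.1 (h v hv)
    obtain ⟨b, -, hb⟩ := degree_eq_one_iff_existsUnique_adj.1 (h w hw)
    have key : ∀ x y, G.Walk x y → (x = v ∨ x = w) → (y = v ∨ y = w) := by
      intro x y p
      induction p with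
      | nil => exact id
      | cons hadj _ ih =>
        rintro (rfl | rfl)
        · exact ih (Or.inr ((ha _ hadj).trans (ha _ hvw).symm))
        · exact ih (Or.inl ((hb _ hadj).trans (hb _ hvw.symm).symm))
    obtain ⟨p⟩ := hG.preconnected v c
    rcases key v c p (Or.inl rfl) with e | e
    · exact hv e.symm
    · exact hw e.symm
  have leaf : ∀ v, v ≠ c → G.Adj v c := by
    intro v hv
    obtain ⟨a, ha, -⟩ := degree_eq_one_iff_existsUnique_adj.1 (h v hv)
    exact center v hv a ha ▸ ha
  constructor
  · intro huv
    by_cases hu : u = c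
    · exact Or.inl ⟨hu, fun hv => huv.ne (hu.trans hv.symm)⟩
    · exact Or.inr ⟨hu, center u hu v huv⟩
  · rintro (⟨rfl, hv⟩ | ⟨hu, rfl⟩)
    · exact (leaf v hv).symm
    · exact leaf u hu

theorem nonempty_iso_star_of_adj_iff [Fintype V] {c : V} {m : ℕ}
    (hcard : Fintype.card V = m + 1)
    (h : ∀ u v, G.Adj u v ↔ (u = c ∧ v ≠ c) ∨ (u ≠ c ∧ v = c)) :
    Nonempty (G ≃g completeBipartiteGraph (Fin 1) (Fin m)) := by
  classical
  have e₁ : {v // v = c} ≃ Fin 1 := Fintype.equivFinOfCardEq (by simp)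
  have e₂ : {v // ¬ v = c} ≃ Fin m :=
    Fintype.equivFinOfCardEq (by rw [Fintype.card_subtype_compl]; simp [hcard])
  let e := (Equiv.sumCompl (· = c)).symm.trans (Equiv.sumCongr e₁ e₂)
  have hl : ∀ v, (e v).isLeft = true ↔ v = c := by
    intro v
    by_cases hv : v = c
    · simp [e, Equiv.sumCompl_symm_apply_of_pos, hv]
    · simp [e, Equiv.sumCompl_symm_apply_of_neg, hv]
  have hr : ∀ v, (e v).isRight = true ↔ v ≠ c := by
    intro v
    rw [ne_eq, ← hl v, ← Sum.not_isLeft]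
  refine ⟨⟨e, fun {u v} => ?_⟩⟩
  rw [h, completeBipartiteGraph_adj, hl, hl, hr, hr]

end SimpleGraph

section Labeling

variable {V : Type*} {G : SimpleGraph V} {X : Finset ℕ} {f : V → Finset ℕ}

/-- The induced edge function of a vertex labeling. -/
def sumsetEdgeLabel (f : V → Finset ℕ) : Sym2 V → Finset ℕ :=
  Sym2.lift ⟨fun u v => f u + f v, fun _ _ => add_comm _ _⟩

theorem IsIASGL.injOn_sumsetEdgeLabel (hf : IsIASGL G X f) :
    Set.InjOn (sumsetEdgeLabel f) G.edgeSet := by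
  intro e he e' he'
  induction e with | _ u v
  induction e' with | _ u' v'
  exact hf.2.2.1 u v u' v' he he'

theorem IsIASGL.image_edgeFinset [Fintype V] [DecidableRel G.Adj] (hf : IsIASGL G X f) :
    G.edgeFinset.image (sumsetEdgeLabel f) = gracefulLabels X := by
  ext A
  rw [mem_gracefulLabels, ← hf.2.2.2 A, Finset.mem_image]
  constructor
  · rintro ⟨e, he, rfl⟩
    induction e with | _ u v
    exact ⟨u, v, by simpa using he, rfl⟩
  · rintro ⟨u, v, h, rfl⟩
    exact ⟨s(u, v), by simpa using h, rfl⟩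

theorem IsIASGL.card_edgeFinset [Fintype V] [DecidableRel G.Adj] (hf : IsIASGL G X f)
    (h0 : 0 ∈ X) : G.edgeFinset.card = 2 ^ X.card - 2 := by
  rw [← card_gracefulLabels h0, ← hf.image_edgeFinset, Finset.card_image_of_injOn]
  simpa using hf.injOn_sumsetEdgeLabel

theorem IsIASGL.sum_edgeFinset_sup [Fintype V] [DecidableEq V] [DecidableRel G.Adj]
    (hf : IsIASGL G X f) :
    ∑ e ∈ G.edgeFinset, ∑ v ∈ e.toFinset, (f v).sup id = ∑ A ∈ gracefulLabels X, A.sup id := by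
  rw [← hf.image_edgeFinset, Finset.sum_image (by simpa using hf.injOn_sumsetEdgeLabel)]
  refine Finset.sum_congr rfl fun e he => ?_
  induction e with | _ u v
  have huv : u ≠ v := G.ne_of_adj (by simpa using he)
  rw [Sym2.toFinset_mk_eq, Finset.sum_pair huv]
  exact (Finset.sup_id_add_of_nonempty (hf.2.1 u).1 (hf.2.1 v).1).symm

theorem IsIASGL.image_univ [Fintype V] (hf : IsIASGL G X f) (h0 : 0 ∈ X)
    (hcard : Fintype.card V = 2 ^ X.card - 2 + 1) :
    Finset.univ.image f = insert {0} (gracefulLabels X) := by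
  refine Finset.eq_of_subset_of_card_le (fun A hA => ?_) ?_
  · obtain ⟨v, -, rfl⟩ := Finset.mem_image.1 hA
    have := hf.2.1 v
    rw [Finset.mem_insert, mem_gracefulLabels]
    tauto
  · rw [Finset.card_image_of_injective _ hf.1, Finset.card_univ, hcard,
      ← card_gracefulLabels h0]
    exact Finset.card_insert_le _ _

theorem IsIASGL.exists_degree_eq_one [Fintype V] [DecidableRel G.Adj] (hf : IsIASGL G X f)
    (hG : G.Connected) (h0 : 0 ∈ X) (hX : 2 ≤ X.card)
    (hcard : Fintype.card V = 2 ^ X.card - 2 + 1) :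
    ∃ c, ∀ v, v ≠ c → G.degree v = 1 := by
  classical
  have himg := hf.image_univ h0 hcard
  obtain ⟨c, -, hc⟩ := Finset.mem_image.1 (himg ▸ Finset.mem_insert_self {0} (gracefulLabels X))
  have : Nontrivial V := by
    rw [← Fintype.one_lt_card_iff_nontrivial, hcard]
    have : 2 ^ 2 ≤ 2 ^ X.card := Nat.pow_le_pow_right (by norm_num) hX
    omega
  have hsum : ∑ v, (f v).sup id = ∑ v, G.degree v * (f v).sup id := by
    rw [SimpleGraph.sum_degree_mul, hf.sum_edgeFinset_sup,
      ← Finset.sum_image (f := fun A : Finset ℕ => A.sup id) hf.1.injOn, himg,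
      Finset.sum_insert (by simp [mem_gracefulLabels])]
    simp
  have heq := (Finset.sum_eq_sum_iff_of_le fun v _ =>
    Nat.le_mul_of_pos_left _ (hG.preconnected.degree_pos_of_nontrivial v)).1 hsum
  refine ⟨c, fun v hv => ?_⟩
  have hpos := Finset.sup_id_pos_of_ne_singleton_zero (hf.2.1 v).1
    fun h => hv (hf.1 (h.trans hc.symm))
  exact Nat.eq_of_mul_eq_mul_right hpos ((heq v (Finset.mem_univ v)).symm.trans (one_mul _).symm)

/-- The labeling of the star with centre labeled `{0}` and leaves labeled by all other
nonempty subsets of `X`. -/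
theorem exists_isIASGL_star (h0 : 0 ∈ X) :
    ∃ f, IsIASGL (completeBipartiteGraph (Fin 1) (Fin (2 ^ X.card - 2))) X f := by
  let e := ((gracefulLabels X).equivFinOfCardEq (card_gracefulLabels h0)).symm
  have he : ∀ i, (e i : Finset ℕ) ⊆ X ∧ (e i : Finset ℕ).Nonempty ∧ (e i : Finset ℕ) ≠ {0} :=
    fun i => mem_gracefulLabels.1 (e i).2
  have hz : ∀ A : Finset ℕ, {0} + A = A := fun A => by ext; simp [Finset.mem_add]
  have hz' : ∀ A : Finset ℕ, A + {0} = A := fun A => by ext; simp [Finset.mem_add]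
  refine ⟨Sum.elim (fun _ => {0}) (fun i => (e i : Finset ℕ)), ?_, ?_, ?_, ?_⟩
  · exact Function.Injective.sumElim (Function.injective_of_subsingleton _)
      (Subtype.val_injective.comp e.injective) fun _ i => ((he i).2.2).symm
  · rintro (i | i)
    · simp [h0]
    · exact ⟨(he i).2.1, (he i).1⟩
  · rintro (a | i) (b | j) (a' | i') (b' | j') h h' heq <;>
      simp_all [Subsingleton.elim _ (0 : Fin 1)]
  · intro A
    constructor
    · rintro ⟨a | i, b | j, h, rfl⟩
      · simp at h
      · simpa [hz] using he j
      · simpa [hz'] using he i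
      · simp at h
    · intro hA
      refine ⟨Sum.inl 0, Sum.inr (e.symm ⟨A, mem_gracefulLabels.2 hA⟩), by simp, ?_⟩
      simp [hz]

theorem IsIASGL.comp_iso {W : Type*} {H : SimpleGraph W} {g : W → Finset ℕ}
    (hg : IsIASGL H X g) (φ : G ≃g H) : IsIASGL G X (g ∘ φ) := by
  obtain ⟨h₁, h₂, h₃, h₄⟩ := hg
  refine ⟨h₁.comp φ.injective, fun v => h₂ _, fun u v u' v' h h' heq => ?_, fun A => ?_⟩
  · have := h₃ _ _ _ _ (φ.map_adj_iff.2 h) (φ.map_adj_iff.2 h') heq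
    exact Sym2.map.injective φ.injective (by simpa using this)
  · rw [← h₄]
    constructor
    · rintro ⟨u, v, h, rfl⟩
      exact ⟨φ u, φ v, φ.map_adj_iff.2 h, rfl⟩
    · rintro ⟨u, v, h, rfl⟩
      exact ⟨φ.symm u, φ.symm v, φ.symm.map_adj_iff.2 h, by simp⟩

end Labeling

theorem stmt_6 {V : Type*} [Fintype V] (G : SimpleGraph V)
    (hconn : G.Connected) (hac : G.IsAcyclic)
    (X : Finset ℕ) (h0 : 0 ∈ X) (hX : 2 ≤ X.card) :
    (∃ f : V → Finset ℕ, IsIASGL G X f) ↔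
      Nonempty (G ≃g completeBipartiteGraph (Fin 1) (Fin (2 ^ X.card - 2))) := by
  classical
  constructor
  · rintro ⟨f, hf⟩
    have hcard : Fintype.card V = 2 ^ X.card - 2 + 1 := by
      rw [← hf.card_edgeFinset h0]
      exact (SimpleGraph.IsTree.mk hconn hac).card_edgeFinset.symm
    obtain ⟨c, hc⟩ := hf.exists_degree_eq_one hconn h0 hX hcard
    exact SimpleGraph.nonempty_iso_star_of_adj_iff hcard (hconn.adj_iff_of_degree_eq_one hc)
  · rintro ⟨φ⟩
    obtain ⟨f, hf⟩ := exists_isIASGL_star h0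
    exact ⟨_, hf.comp_iso φ⟩
end

section
/- If a connected graph G with at least two vertices admits a topological integer additive set-labeling with respect to a ground set X, then G has at least one pendant vertex. -/
open Finset Pointwise

/-- If a finite set of natural numbers absorbs translation by a nonempty set, then that set
is `{0}`. -/
theorem Finset.eq_singleton_zero_of_add_subset {A X : Finset ℕ} (hX : X.Nonempty)
    (hA : A.Nonempty) (h : A + X ⊆ X) : A = {0} := by
  refine Finset.eq_singleton_iff_nonempty_unique_mem.2 ⟨hA, fun a ha => ?_⟩
  have := X.le_max' _ (h (Finset.add_mem_add ha (X.max'_mem hX)))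
  omega

theorem stmt_7 {V : Type*} [Fintype V] [DecidableEq V] (G : SimpleGraph V)
    [DecidableRel G.Adj] (hconn : G.Connected) (hV : 2 ≤ Fintype.card V)
    (X : Finset ℕ) (f : V → Finset ℕ) (hf : IsTopIASL G X f) :
    ∃ v : V, G.degree v = 1 := by
  obtain ⟨hinj, hsub, hadd, -, -, hXmem, -⟩ := hf
  have : Nontrivial V := Fintype.one_lt_card_iff_nontrivial.1 hV
  obtain ⟨w⟩ := hconn.nonempty
  have hX : X.Nonempty := (hsub w).1.mono (hsub w).2
  obtain ⟨v, hv⟩ := hXmem.resolve_left hX.ne_empty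
  have key : ∀ u, G.Adj v u → f u = {0} := fun u hu =>
    Finset.eq_singleton_zero_of_add_subset hX (hsub u).1 (by
      simpa only [hv] using hadd u v hu.symm)
  obtain ⟨u, hu⟩ := (G.degree_pos_iff_exists_adj v).1 (hconn.preconnected.degree_pos_of_nontrivial v)
  exact ⟨v, SimpleGraph.degree_eq_one_iff_existsUnique_adj.2
    ⟨u, hu, fun y hy => hinj ((key y hy).trans (key u hu).symm)⟩⟩
end

section
/- Let f be a topological integer additive set-labeling of a connected graph G with at least two vertices, with respect to a ground set X. If the maximal element of X belongs to f(v) for a vertex v of G, then v is a pendant vertex (it has degree 1) and its unique neighbour u satisfies f(u) = {0}; in particular 0 ∈ X. -/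
open Finset Pointwise

theorem stmt_8 {V : Type*} [Fintype V] [DecidableEq V] (G : SimpleGraph V)
    [DecidableRel G.Adj] (hconn : G.Connected) (hV : 2 ≤ Fintype.card V)
    (X : Finset ℕ) (f : V → Finset ℕ) (hf : IsTopIASL G X f) (v : V)
    (hv : X.max' (Finset.Nonempty.mono (hf.2.1 v).2 (hf.2.1 v).1) ∈ f v) :
    G.degree v = 1 ∧ (∀ u : V, G.Adj v u → f u = ({0} : Finset ℕ)) ∧ 0 ∈ X := by
  have hnbr : ∀ u : V, G.Adj v u → f u = ({0} : Finset ℕ) := by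
    intro u hu
    refine Finset.eq_singleton_iff_nonempty_unique_mem.2 ⟨(hf.2.1 u).1, fun a ha => ?_⟩
    have hle := X.le_max' _ (hf.2.2.1 v u hu (Finset.add_mem_add hv ha))
    omega
  have : Nontrivial V := Fintype.one_lt_card_iff_nontrivial.1 hV
  obtain ⟨u, hu⟩ := hconn.preconnected.exists_adj_of_nontrivial v
  refine ⟨?_, hnbr, ?_⟩
  · rw [SimpleGraph.degree_eq_one_iff_existsUnique_adj]
    exact ⟨u, hu, fun w hw => hf.1 ((hnbr w hw).trans (hnbr u hu).symm)⟩
  · exact (hf.2.1 u).2 (by simp [hnbr u hu])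
end

section
/- Let G be a connected graph with at least two vertices that admits a topological integer additive set-labeling f with respect to a ground set X such that f(V(G)) equals the collection of all nonempty subsets of X (so that f(V(G)) ∪ {∅} is the discrete topology on X). Then |X| ≥ 2, 0 ∈ X, and there exists a vertex w of G such that at least 2^{|X|−1} pendant vertices of G are adjacent to w. -/
open Finset Pointwise

/-- If two nonempty sets of naturals sum into `X` and one of them contains the maximum of `X`,
then the other is `{0}`. -/
theorem eq_singleton_zero_of_add_subset {X A B : Finset ℕ} {m : ℕ} (hm : ∀ x ∈ X, x ≤ m)
    (hmA : m ∈ A) (hB : B.Nonempty) (hAB : A + B ⊆ X) : B = {0} := by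
  refine Finset.eq_singleton_iff_nonempty_unique_mem.2 ⟨hB, fun b hb => ?_⟩
  have := hm _ (hAB (Finset.add_mem_add hmA hb))
  omega

/-- If at least two vertices are injectively labelled by nonempty subsets of `X`, then `X` has at
least two elements. -/
theorem two_le_card_of_injective_nonempty_subset {V : Type*} [Fintype V]
    (hV : 2 ≤ Fintype.card V) {X : Finset ℕ} {f : V → Finset ℕ} (hinj : Function.Injective f)
    (hsub : ∀ v, (f v).Nonempty ∧ f v ⊆ X) : 2 ≤ X.card := by
  have hle : Fintype.card V ≤ (X.powerset.erase ∅).card :=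
    Finset.card_le_card_of_injOn f
      (fun v _ => Finset.mem_erase.2
        ⟨(hsub v).1.ne_empty, Finset.mem_powerset.2 (hsub v).2⟩) hinj.injOn
  rw [Finset.card_erase_of_mem (Finset.empty_mem_powerset X), Finset.card_powerset] at hle
  by_contra! h
  have : 2 ^ X.card ≤ 2 ^ 1 := Nat.pow_le_pow_right (by norm_num) (by omega)
  omega

theorem stmt_9 {V : Type*} [Fintype V] [DecidableEq V] (G : SimpleGraph V)
    [DecidableRel G.Adj] (hconn : G.Connected) (hV : 2 ≤ Fintype.card V)
    (X : Finset ℕ) (f : V → Finset ℕ) (hf : IsTopIASL G X f)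
    (hdisc : Set.range f = {A : Finset ℕ | A ⊆ X ∧ A.Nonempty}) :
    2 ≤ X.card ∧ 0 ∈ X ∧
      ∃ w : V, 2 ^ (X.card - 1) ≤
        (Finset.univ.filter fun v => G.degree v = 1 ∧ G.Adj v w).card := by
  obtain ⟨hinj, hsub, hadj, -⟩ := hf
  have hcard := two_le_card_of_injective_nonempty_subset hV hinj hsub
  have hne : X.Nonempty := Finset.card_pos.1 (by omega)
  have hmX := X.max'_mem hne
  have hmax : ∀ x ∈ X, x ≤ X.max' hne := fun x hx => X.le_max' x hx
  generalize X.max' hne = m at hmX hmax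
  have : Nontrivial V := Fintype.one_lt_card_iff_nontrivial.1 hV
  have hsurj : ∀ A ⊆ X, A.Nonempty → ∃ v, f v = A := fun A hA hA' => by
    have : A ∈ Set.range f := by rw [hdisc]; exact ⟨hA, hA'⟩
    exact this
  have hzero : ∀ u v, m ∈ f u → G.Adj u v → f v = {0} := fun u v hu huv =>
    eq_singleton_zero_of_add_subset hmax hu (hsub v).1 (hadj u v huv)
  obtain ⟨u, hu⟩ := hsurj X subset_rfl hne
  obtain ⟨w, huw⟩ := hconn.preconnected.exists_adj_of_nontrivial u
  have hw : f w = {0} := hzero u w (hu ▸ hmX) huw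
  refine ⟨hcard, (hsub w).2 (by simp [hw]), w, ?_⟩
  have hpendant : ∀ v, m ∈ f v → G.degree v = 1 ∧ G.Adj v w := fun v hv => by
    have huniq : ∀ y, G.Adj v y → y = w := fun y hy => hinj ((hzero v y hv hy).trans hw.symm)
    obtain ⟨y, hy⟩ := hconn.preconnected.exists_adj_of_nontrivial v
    have hvw : G.Adj v w := huniq y hy ▸ hy
    exact ⟨SimpleGraph.degree_eq_one_iff_existsUnique_adj.2 ⟨w, hvw, huniq⟩, hvw⟩
  rw [← Finset.card_erase_of_mem hmX, ← Finset.card_powerset]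
  refine Finset.card_le_card_of_surjOn (fun v => (f v).erase m) fun S hS => ?_
  have hS' : S ⊆ X.erase m := Finset.mem_powerset.1 hS
  obtain ⟨v, hv⟩ := hsurj (insert m S)
    (Finset.insert_subset hmX (hS'.trans (Finset.erase_subset m X))) (Finset.insert_nonempty m S)
  refine ⟨v, ?_, ?_⟩
  · simpa using hpendant v (by simp [hv])
  · simp [hv, Finset.erase_insert fun h => Finset.notMem_erase m X (hS' h)]
end

section
/- Let X be a finite set of non-negative integers with 0 ∈ X, and let T be a topology on X (a family of subsets of X containing ∅ and X and closed under pairwise unions and pairwise intersections) such that {0} ∈ T, with |T| = r. Then the star graph K_{1, r−2} admits a topological integer additive set-labeling f with respect to X whose image satisfies f(V(K_{1,r−2})) = T \ {∅}; that is, every topology on X containing {0} is graphically realisable. -/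
open Finset Pointwise

theorem stmt_10 (X : Finset ℕ) (h0 : 0 ∈ X) (T : Finset (Finset ℕ)) (r : ℕ)
    (hr : T.card = r) (hT : IsTopologyFamily X (↑T : Set (Finset ℕ)))
    (h0T : ({0} : Finset ℕ) ∈ T) :
    ∃ f : Fin 1 ⊕ Fin (r - 2) → Finset ℕ,
      IsTopIASL (completeBipartiteGraph (Fin 1) (Fin (r - 2))) X f ∧
      Set.range f = (↑T : Set (Finset ℕ)) \ {(∅ : Finset ℕ)} := by
  obtain ⟨hsub, hempty, hX, hunion, hinter⟩ := hT
  have hcard : ((T.erase ∅).erase {0}).card = r - 2 := by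
    rw [card_erase_of_mem (mem_erase.2 ⟨singleton_ne_empty 0, h0T⟩),
      card_erase_of_mem (mem_coe.1 hempty), hr, Nat.sub_sub]
  let e := equivFinOfCardEq hcard
  have he (i : Fin (r - 2)) :
      (e.symm i : Finset ℕ) ≠ {0} ∧ (e.symm i : Finset ℕ) ≠ ∅ ∧ (e.symm i : Finset ℕ) ∈ T := by
    simpa only [mem_erase] using (e.symm i).2
  let f : Fin 1 ⊕ Fin (r - 2) → Finset ℕ := Sum.elim (fun _ ↦ {0}) (fun i ↦ e.symm i)
  have hrange : Set.range f = (↑T : Set (Finset ℕ)) \ {(∅ : Finset ℕ)} := by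
    ext A
    constructor
    · rintro ⟨i | i, rfl⟩
      · exact ⟨h0T, singleton_ne_empty 0⟩
      · exact ⟨(he i).2.2, (he i).2.1⟩
    · rintro ⟨hA, hA'⟩
      by_cases hA0 : A = {0}
      · exact ⟨Sum.inl 0, hA0.symm⟩
      · exact ⟨Sum.inr (e ⟨A, mem_erase.2 ⟨hA0, mem_erase.2 ⟨hA', hA⟩⟩⟩), by simp [f]⟩
  have hf (v) : f v ∈ T ∧ f v ≠ ∅ := by
    have hv : f v ∈ (↑T : Set (Finset ℕ)) \ {(∅ : Finset ℕ)} := hrange ▸ Set.mem_range_self v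
    exact hv
  refine ⟨f, ⟨?_, fun v ↦ ⟨nonempty_iff_ne_empty.2 (hf v).2, hsub _ (hf v).1⟩, ?_, ?_⟩, hrange⟩
  · exact (Function.injective_of_subsingleton _).sumElim
      (Subtype.val_injective.comp e.symm.injective) fun _ i ↦ (he i).1.symm
  · rintro (u | u) (v | v) h
    · simp at h
    · change ({0} : Finset ℕ) + f (Sum.inr v) ⊆ X
      rw [singleton_zero, zero_add]
      exact hsub _ (hf _).1
    · change f (Sum.inr u) + ({0} : Finset ℕ) ⊆ X
      rw [singleton_zero, add_zero]
      exact hsub _ (hf _).1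
    · simp at h
  · rw [hrange, Set.insert_sdiff_singleton, Set.insert_eq_of_mem hempty]
    exact ⟨hsub, hempty, hX, hunion, hinter⟩
end

section
/- Let X be a finite set of non-negative integers with |X| ≥ 2. A tree G (a connected acyclic graph) admits an integer additive set-graceful labeling with respect to X if and only if G admits a topological integer additive set-graceful labeling with respect to X; indeed, any IASGL of a tree G with respect to X is automatically a Top-IASGL. -/
open Finset Pointwise

/-- In a finite tree, an edge function that hits every subset of `X` other than `∅` and `{0}`
forces at least `2 ^ |X| - 1` vertices. -/
lemma two_pow_card_le_card_succ_of_isTree {V : Type*} [Fintype V] {G : SimpleGraph V}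
    (hG : G.IsTree) {X : Finset ℕ} {f : V → Finset ℕ}
    (h : ∀ A ⊆ X, A.Nonempty → A ≠ {0} → ∃ u v, G.Adj u v ∧ f u + f v = A) :
    2 ^ X.card ≤ Fintype.card V + 1 := by
  classical
  let g : Sym2 V → Finset ℕ := Sym2.lift ⟨fun u v => f u + f v, fun _ _ => add_comm _ _⟩
  have hsub : X.powerset \ {∅, {0}} ⊆ G.edgeFinset.image g := by
    intro A hA
    simp only [mem_sdiff, mem_powerset, mem_insert, mem_singleton, not_or] at hA
    obtain ⟨u, v, huv, rfl⟩ := h A hA.1 (nonempty_iff_ne_empty.mpr hA.2.1) hA.2.2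
    exact mem_image.mpr ⟨s(u, v), by simpa using huv, rfl⟩
  have hle := (card_le_card hsub).trans card_image_le
  have hsdiff := le_card_sdiff ({∅, {0}} : Finset (Finset ℕ)) X.powerset
  have htwo : ({∅, {0}} : Finset (Finset ℕ)).card ≤ 2 := card_le_two
  have htree := hG.card_edgeFinset
  rw [card_powerset] at hsdiff
  omega

/-- The vertex labels of an IASGL of a tree are exactly the nonempty subsets of `X`. -/
lemma IsIASGL.mem_range_iff {V : Type*} [Fintype V] {G : SimpleGraph V} (hG : G.IsTree)
    {X : Finset ℕ} {f : V → Finset ℕ} (hf : IsIASGL G X f) (A : Finset ℕ) :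
    A ∈ Set.range f ↔ A ⊆ X ∧ A.Nonempty := by
  classical
  obtain ⟨hinj, hv, -, hE⟩ := hf
  have hcard := two_pow_card_le_card_succ_of_isTree hG
    fun A hA hne h0 => (hE A).mpr ⟨hA, hne, h0⟩
  have hsub : univ.image f ⊆ X.powerset.erase ∅ := by
    intro A hA
    obtain ⟨v, -, rfl⟩ := mem_image.mp hA
    exact mem_erase.mpr ⟨(hv v).1.ne_empty, mem_powerset.mpr (hv v).2⟩
  have himage : univ.image f = X.powerset.erase ∅ := by
    refine eq_of_subset_of_card_le hsub ?_
    rw [card_erase_of_mem (empty_mem_powerset X), card_powerset,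
      card_image_of_injective _ hinj, card_univ]
    omega
  have hmem := Finset.ext_iff.mp himage A
  simpa [nonempty_iff_ne_empty, and_comm] using hmem

/-- The family of all subsets of `X` is a topology on `X`. -/
lemma isTopologyFamily_of_forall_mem_iff {X : Finset ℕ} {T : Set (Finset ℕ)}
    (hT : ∀ A, A ∈ T ↔ A ⊆ X) : IsTopologyFamily X T := by
  simp only [IsTopologyFamily, hT]
  exact ⟨fun _ h => h, empty_subset X, Subset.refl X, fun _ hA _ hB => union_subset hA hB,
    fun _ hA _ _ => inter_subset_left.trans hA⟩

lemma IsIASGL.isTopIASGL_of_isTree {V : Type*} [Fintype V] {G : SimpleGraph V}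
    (hG : G.IsTree) {X : Finset ℕ} {f : V → Finset ℕ} (hf : IsIASGL G X f) :
    IsTopIASGL G X f := by
  refine ⟨hf, isTopologyFamily_of_forall_mem_iff fun A => ?_⟩
  rw [Set.mem_insert_iff, hf.mem_range_iff hG]
  obtain rfl | hA := A.eq_empty_or_nonempty
  · simp
  · simp [hA, hA.ne_empty]

theorem stmt_11 {V : Type*} [Fintype V] (G : SimpleGraph V)
    (hconn : G.Connected) (hac : G.IsAcyclic)
    (X : Finset ℕ) (hX : 2 ≤ X.card) :
    (∀ f : V → Finset ℕ, IsIASGL G X f → IsTopIASGL G X f) ∧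
    ((∃ f : V → Finset ℕ, IsIASGL G X f) ↔ ∃ f : V → Finset ℕ, IsTopIASGL G X f) := by
  have htop (f : V → Finset ℕ) (hf : IsIASGL G X f) : IsTopIASGL G X f :=
    hf.isTopIASGL_of_isTree ⟨hconn, hac⟩
  exact ⟨htop, fun ⟨f, hf⟩ => ⟨f, htop f hf⟩, fun ⟨f, hf⟩ => ⟨f, hf.1⟩⟩
end

section
/- No connected regular graph on at least two vertices admits a topological integer additive set-graceful labeling with respect to any ground set X with |X| ≥ 2. That is, if G is connected with at least two vertices and all vertices of G have the same degree, then G admits no Top-IASGL with respect to X. -/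
open Finset Pointwise

/-- If a nonempty finite set `X` of naturals satisfies `X + B ⊆ X`, then `B ⊆ {0}`. -/
theorem eq_zero_of_add_subset_self {X B : Finset ℕ} (hX : X.Nonempty) (h : X + B ⊆ X) :
    ∀ b ∈ B, b = 0 := by
  intro b hb
  have := X.le_max' _ (h (Finset.add_mem_add (X.max'_mem hX) hb))
  omega

/-- In a connected graph, a set of vertices closed under adjacency and containing one vertex
contains all of them. -/
theorem SimpleGraph.Connected.forall_of_adj_closed {V : Type*} {G : SimpleGraph V}
    (hG : G.Connected) {p : V → Prop} (hp : ∀ a b, G.Adj a b → p a → p b) {v : V} (hv : p v)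
    (w : V) : p w := by
  obtain ⟨walk⟩ := hG.preconnected v w
  induction walk with
  | nil => exact hv
  | cons h _ ih => exact ih (hp _ _ h hv)

theorem stmt_13 {V : Type*} [Fintype V] [DecidableEq V] (G : SimpleGraph V)
    [DecidableRel G.Adj] (hconn : G.Connected) (hV : 2 ≤ Fintype.card V)
    (r : ℕ) (hreg : G.IsRegularOfDegree r)
    (X : Finset ℕ) (hX : 2 ≤ X.card) :
    ¬ ∃ f : V → Finset ℕ, IsTopIASGL G X f := by
  rintro ⟨f, ⟨hinj, hne, -, himg⟩, -, -, hXT, -, -⟩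
  have hXne : X.Nonempty := card_pos.mp (by omega)
  obtain ⟨v, hv⟩ : ∃ v, f v = X := by
    rcases hXT with h | h
    · exact absurd h hXne.ne_empty
    · exact h
  have hnbr : ∀ w, G.Adj v w → f w = {0} := fun w hw =>
    eq_singleton_iff_nonempty_unique_mem.mpr ⟨(hne w).1,
      eq_zero_of_add_subset_self hXne (hv ▸ ((himg _).mp ⟨v, w, hw, rfl⟩).1)⟩
  have : Nontrivial V := Fintype.one_lt_card_iff_nontrivial.mp hV
  obtain ⟨u, hu⟩ := hconn.preconnected.exists_adj_of_nontrivial v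
  have hr : r = 1 := by
    rw [← hreg v, ← G.card_neighborFinset_eq_degree, card_eq_one]
    refine ⟨u, eq_singleton_iff_unique_mem.mpr ⟨by simpa using hu, fun w hw => hinj ?_⟩⟩
    rw [hnbr w (by simpa using hw), hnbr u hu]
  have huniq : ∀ a b c, G.Adj a b → G.Adj a c → b = c := fun a b c hb hc =>
    card_le_one.mp ((G.card_neighborFinset_eq_degree a).trans_le ((hreg a).trans hr).le)
      b (by simpa using hb) c (by simpa using hc)
  have hall : ∀ w, w = v ∨ w = u := by
    refine hconn.forall_of_adj_closed (v := v) ?_ (Or.inl rfl)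
    rintro a b hab (rfl | rfl)
    · exact Or.inr (huniq _ _ _ hab hu)
    · exact Or.inl (huniq _ _ _ hab hu.symm)
  obtain ⟨x, hxX, hx0⟩ := exists_mem_ne hX 0
  obtain ⟨a, b, hab, hsum⟩ := (himg {x}).mpr ⟨by simpa using hxX, by simp, by simpa using hx0⟩
  have hXx : X = {x} := by
    have h0 := hnbr u hu
    rcases hall a with rfl | rfl
    · rwa [hv, hnbr b hab, Finset.singleton_zero, add_zero] at hsum
    · rwa [huniq _ _ _ hab hu.symm, hv, h0, Finset.singleton_zero, zero_add] at hsum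
  simp [hXx] at hX
end
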